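/- In the Setup, let P be a piece of X and x ∈ X. If d(x, P) ≤ r and π_P(x) ∉ 𝔠_P, then c*_X(x) = c*_X(π_P(x)). -/

import Mathlib

open Set Metric

section Core

variable {X : Type*} [MetricSpace X]

/-- A geodesic segment parametrized by the interval `[a, b]`:
an isometric embedding of `[a, b]` into `X`. -/
def IsGeodesicSegment (γ : ℝ → X) (a b : ℝ) : Prop :=
  ∀ s ∈ Set.Icc a b, ∀ t ∈ Set.Icc a b, dist (γ s) (γ t) = |s - t|

/-- A metric space is geodesic if every two points are joined by a geodesic. -/
def GeodesicSpace (X : Type*) [MetricSpace X] : Prop :=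
  ∀ x y : X, ∃ γ : ℝ → X, IsGeodesicSegment γ 0 (dist x y) ∧ γ 0 = x ∧ γ (dist x y) = y

/-- A subset is geodesic if every two of its points are joined by a geodesic of `X`
contained in the subset. -/
def IsGeodesicSubset (S : Set X) : Prop :=
  ∀ x ∈ S, ∀ y ∈ S, ∃ γ : ℝ → X, IsGeodesicSegment γ 0 (dist x y) ∧ γ 0 = x ∧
    γ (dist x y) = y ∧ ∀ t ∈ Set.Icc (0 : ℝ) (dist x y), γ t ∈ S

/-- A (complete geodesic) metric space is tree-graded with respect to a collection `PX`
of closed geodesic subsets (pieces) covering `X` if every two different pieces meet in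
at most one point (T₁) and every simple loop (injective continuous image of a circle)
is contained in one piece (T₂''). -/
structure IsTreeGraded (X : Type*) [MetricSpace X] (PX : Set (Set X)) : Prop where
  nonempty : ∀ P ∈ PX, P.Nonempty
  closed : ∀ P ∈ PX, IsClosed P
  geodesicSub : ∀ P ∈ PX, IsGeodesicSubset P
  covers : ∀ x : X, ∃ P ∈ PX, x ∈ P
  t1 : ∀ P ∈ PX, ∀ Q ∈ PX, P ≠ Q → (P ∩ Q).Subsingleton
  t2 : ∀ loop : AddCircle (1 : ℝ) → X, Continuous loop → Function.Injective loop →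
    ∃ P ∈ PX, Set.range loop ⊆ P

end Core
section Chains

variable {Y : Type*}

/-- An `r`-chain from `x` to `y` inside the set `S`, with respect to the distance
function `d`: a finite sequence `x = c 0, c 1, …, c m = y` of points of `S` with
consecutive distances `< r`. -/
def IsDChain (d : Y → Y → ℝ) (r : ℝ) (S : Set Y) (x y : Y) : Prop :=
  ∃ (m : ℕ) (c : ℕ → Y), c 0 = x ∧ c m = y ∧ (∀ i ≤ m, c i ∈ S) ∧
    ∀ i < m, d (c i) (c (i + 1)) < r

/-- A set is `r`-scale connected if every two of its points are joined by an
`r`-chain contained in it. -/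
def DScaleConnected (d : Y → Y → ℝ) (r : ℝ) (S : Set Y) : Prop :=
  ∀ x ∈ S, ∀ y ∈ S, IsDChain d r S x y

/-- `C` is an `r`-scale connected component of `U`: a maximal `r`-scale connected
subset of `U`. -/
def IsDComponent (d : Y → Y → ℝ) (r : ℝ) (U C : Set Y) : Prop :=
  C ⊆ U ∧ DScaleConnected d r C ∧
    ∀ C', C ⊆ C' → C' ⊆ U → DScaleConnected d r C' → C = C'

/-- A set is `M`-bounded: its diameter is at most `M`. -/
def DBounded (d : Y → Y → ℝ) (M : ℝ) (S : Set Y) : Prop :=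
  ∀ x ∈ S, ∀ y ∈ S, d x y ≤ M

/-- A space has dimension `≤ n` at scale `s` of magnitude `M` if there is a cover by
`n + 1` sets such that every `s`-scale connected component of each of them is
`M`-bounded. -/
def DimLeAtScale (d : Y → Y → ℝ) (n : ℕ) (s M : ℝ) : Prop :=
  ∃ U : Fin (n + 1) → Set Y, (∀ y, ∃ i, y ∈ U i) ∧
    ∀ i C, IsDComponent d s (U i) C → DBounded d M C

end Chains
section TreeGradedColoring

variable {X : Type*} [MetricSpace X]

/-- The `r`-scale connected component `𝔠_P` of `c_P`-color `0` of the piece `P`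
containing its base point `x_P = proj P x̂`: the set of points of `P` reachable from
`x_P` by an `r`-chain of points of `P` of `c_P`-color `0`. -/
def pieceComp (r : ℝ) {n : ℕ} (xhat : X) (proj : Set X → X → X)
    (cP : Set X → X → Fin (n + 1)) (P : Set X) : Set X :=
  {y | IsDChain dist r {z | z ∈ P ∧ cP P z = 0} (proj P xhat) y}

/-- `P` is a long piece of the geodesic `γ : [0, L] → X` (from `x̂` to `x = γ L`):
`γ` meets `P` and the exit point `π_P x` does not belong to `𝔠_P`. -/
def IsLongPiece (PX : Set (Set X)) (r : ℝ) {n : ℕ} (xhat : X)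
    (proj : Set X → X → X) (cP : Set X → X → Fin (n + 1))
    (γ : ℝ → X) (L : ℝ) (P : Set X) : Prop :=
  P ∈ PX ∧ (∃ t ∈ Set.Icc 0 L, γ t ∈ P) ∧
    proj P (γ L) ∉ pieceComp r xhat proj cP P

/-- The parameter at which the geodesic `γ : [0, L] → X` enters the piece `P`. -/
noncomputable def pieceStart (γ : ℝ → X) (L : ℝ) (P : Set X) : ℝ :=
  sInf {t | t ∈ Set.Icc 0 L ∧ γ t ∈ P}

/-- The parameter at which the geodesic `γ : [0, L] → X` exits the piece `P`. -/
noncomputable def pieceEnd (γ : ℝ → X) (L : ℝ) (P : Set X) : ℝ :=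
  sSup {t | t ∈ Set.Icc 0 L ∧ γ t ∈ P}

/-- The complement in `γ : [0, L] → X` (in parameter space) of the interiors of all
reduced long pieces of `γ`; its connected components are the subpaths `β₁, …, β_k`. -/
noncomputable def betaSet (PX : Set (Set X)) (r : ℝ) {n : ℕ} (xhat : X)
    (proj : Set X → X → X) (cP : Set X → X → Fin (n + 1))
    (γ : ℝ → X) (L : ℝ) : Set ℝ :=
  Set.Icc 0 L \
    ⋃ P ∈ {P | IsLongPiece PX r xhat proj cP γ L P},
      Set.Ioo (pieceStart γ L P + r / 2) (pieceEnd γ L P)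

/-- The length `|⌊β⌋|` of the initial part of the subpath `β = γ|[a,b]`, where
`⌊β⌋` goes from `β₋ = γ a` to the entry point `β′` of the piece of the induced
tree-graded structure on `β` containing `β₊ = γ b`. -/
noncomputable def floorLen (PX : Set (Set X)) (γ : ℝ → X) (a b : ℝ) : ℝ :=
  sInf {t | t ∈ Set.Icc a b ∧ ∃ P ∈ PX, γ '' Set.Icc t b ⊆ P} - a

/-- `v` is the value at `x = γ L` of the coloring `c*_X` computed along the geodesic
`γ : [0, L] → X` from `x̂` to `x`:
`v = Σ_P c_P(π_P x) + Σᵢ ⌊ |⌊βᵢ⌋| / (99 f(r)) ⌋ (mod n+1)`,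
where the first sum is over the (finitely many) pieces with a nonzero term and
`β₁, …, β_k` are the connected components of the complement in `γ` of the interiors
of the reduced long pieces of `γ`. -/
def ColorValue (PX : Set (Set X)) (r fr : ℝ) {n : ℕ} (xhat : X)
    (proj : Set X → X → X) (cP : Set X → X → Fin (n + 1))
    (γ : ℝ → X) (L : ℝ) (v : Fin (n + 1)) : Prop :=
  ∃ (Ps : Finset (Set X)) (k : ℕ) (a b : Fin k → ℝ),
    (↑Ps : Set (Set X)) = {P | P ∈ PX ∧ cP P (proj P (γ L)) ≠ 0} ∧
    (∀ i, a i ≤ b i) ∧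
    (betaSet PX r xhat proj cP γ L = ⋃ i, Set.Icc (a i) (b i)) ∧
    (∀ i j, i ≠ j → b i < a j ∨ b j < a i) ∧
    (v : ℕ) =
      ((Ps.sum fun P => ((cP P (proj P (γ L)) : ℕ))) +
        (Finset.univ.sum fun i : Fin k =>
          Nat.floor (floorLen PX γ (a i) (b i) / (99 * fr)))) % (n + 1)

/-- The Setup: `X` is a geodesic metric space, tree-graded with respect to `PX`, pieces
do not contain other pieces; `n` is a positive integer, `r > 0` and `f(r) ≥ r`;
`proj P` is the nearest-point projection onto the piece `P`; `x̂` is a base point and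
`x_P = proj P x̂`; `c_P` is a coloring of each piece `P` by `n + 1` colors such that
`r`-components of every nonzero color are `f(r)`-bounded, `r`-components of color `0`
are `8 f(r)`-bounded, and `c_P` vanishes on the closed ball `B(x_P, 2r)`. -/
structure ColoringSetup (X : Type*) [MetricSpace X] (PX : Set (Set X)) (n : ℕ)
    (r fr : ℝ) (xhat : X) (proj : Set X → X → X)
    (cP : Set X → X → Fin (n + 1)) : Prop where
  geodesic : GeodesicSpace X
  treeGraded : IsTreeGraded X PX
  noPieceContainsPiece : ∀ P ∈ PX, ∀ Q ∈ PX, P ⊆ Q → P = Q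
  npos : 0 < n
  rpos : 0 < r
  rlefr : r ≤ fr
  projMem : ∀ P ∈ PX, ∀ x : X, proj P x ∈ P
  projDist : ∀ P ∈ PX, ∀ x : X, dist x (proj P x) = Metric.infDist x P
  ballZero : ∀ P ∈ PX, ∀ y ∈ P, dist y (proj P xhat) ≤ 2 * r → cP P y = 0
  nonzeroBounded : ∀ P ∈ PX, ∀ j : Fin (n + 1), j ≠ 0 →
    ∀ x y : X, IsDChain dist r {z | z ∈ P ∧ cP P z = j} x y → dist x y ≤ fr
  zeroBounded : ∀ P ∈ PX, ∀ x y : X,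
    IsDChain dist r {z | z ∈ P ∧ cP P z = 0} x y → dist x y ≤ 8 * fr

end TreeGradedColoring
/-! ### Arcs -/

/-- The path following `α` up to time `b`, and then `β` from its time `c` on. -/
noncomputable def concatPath {X : Type*} (α β : ℝ → X) (b c : ℝ) (t : ℝ) : X :=
  open Classical in if t ≤ b then α t else β (t - b + c)

theorem concatPath_of_le {X : Type*} {α β : ℝ → X} {b c t : ℝ} (h : t ≤ b) :
    concatPath α β b c t = α t := if_pos h

theorem concatPath_of_lt {X : Type*} {α β : ℝ → X} {b c t : ℝ} (h : b < t) :
    concatPath α β b c t = β (t - b + c) := if_neg (not_le.2 h)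

theorem concatPath_of_ge {X : Type*} {α β : ℝ → X} {b c t : ℝ} (hαβ : α b = β c) (h : b ≤ t) :
    concatPath α β b c t = β (t - b + c) := by
  rcases h.eq_or_lt with rfl | h
  · rw [concatPath_of_le le_rfl, hαβ]; congr 1; ring
  · exact concatPath_of_lt h

theorem injOn_concatPath {X : Type*} {α β : ℝ → X} {b c : ℝ} {A B T : Set ℝ}
    (hα : InjOn α A) (hβ : InjOn β B)
    (hA : ∀ t ∈ T, t ≤ b → t ∈ A) (hB : ∀ t ∈ T, b < t → t - b + c ∈ B)
    (hne : ∀ s ∈ A, ∀ t ∈ B, c < t → α s ≠ β t) :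
    InjOn (concatPath α β b c) T := by
  intro s hs t ht hst
  rcases le_or_gt s b with h1 | h1 <;> rcases le_or_gt t b with h2 | h2
  · rw [concatPath_of_le h1, concatPath_of_le h2] at hst
    exact hα (hA s hs h1) (hA t ht h2) hst
  · rw [concatPath_of_le h1, concatPath_of_lt h2] at hst
    exact absurd hst (hne s (hA s hs h1) _ (hB t ht h2) (by linarith))
  · rw [concatPath_of_lt h1, concatPath_of_le h2] at hst
    exact absurd hst.symm (hne t (hA t ht h2) _ (hB s hs h1) (by linarith))
  · rw [concatPath_of_lt h1, concatPath_of_lt h2] at hst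
    have := hβ (hB s hs h1) (hB t ht h2) hst
    linarith

theorem continuousOn_concatPath {X : Type*} [TopologicalSpace X] {α β : ℝ → X} {a b c d : ℝ}
    (hab : a ≤ b) (hcd : c ≤ d) (hα : ContinuousOn α (Icc a b)) (hβ : ContinuousOn β (Icc c d))
    (hαβ : α b = β c) : ContinuousOn (concatPath α β b c) (Icc a (b + (d - c))) := by
  rw [← Icc_union_Icc_eq_Icc hab (by linarith : b ≤ b + (d - c))]
  refine ContinuousOn.union_of_isClosed ?_ ?_ isClosed_Icc isClosed_Icc
  · exact hα.congr fun t ht => concatPath_of_le ht.2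
  · have h : ContinuousOn (fun t => β (t - b + c)) (Icc b (b + (d - c))) :=
      hβ.comp (by fun_prop) fun t ht => ⟨by linarith [ht.1], by linarith [ht.2]⟩
    exact h.congr fun t ht => concatPath_of_ge hαβ ht.1

/-- `y` and `z` are joined inside `S` by a (possibly degenerate) topological arc. -/
def ArcJoined {X : Type*} [TopologicalSpace X] (S : Set X) (y z : X) : Prop :=
  ∃ (α : ℝ → X) (a b : ℝ), a ≤ b ∧ ContinuousOn α (Icc a b) ∧ InjOn α (Icc a b) ∧
    α a = y ∧ α b = z ∧ MapsTo α (Icc a b) S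

theorem ArcJoined.mono {X : Type*} [TopologicalSpace X] {S T : Set X} {y z : X}
    (h : ArcJoined S y z) (hST : S ⊆ T) : ArcJoined T y z := by
  obtain ⟨α, a, b, hab, hc, hi, ha, hb, hm⟩ := h
  exact ⟨α, a, b, hab, hc, hi, ha, hb, hm.mono_right hST⟩

theorem ArcJoined.symm {X : Type*} [TopologicalSpace X] {S : Set X} {y z : X}
    (h : ArcJoined S y z) : ArcJoined S z y := by
  obtain ⟨α, a, b, hab, hc, hi, ha, hb, hm⟩ := h
  have hmaps : MapsTo (fun t : ℝ => a + b - t) (Icc a b) (Icc a b) :=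
    fun t ht => ⟨by linarith [ht.2], by linarith [ht.1]⟩
  refine ⟨fun t => α (a + b - t), a, b, hab, hc.comp (by fun_prop) hmaps, ?_, ?_, ?_,
    hm.comp hmaps⟩
  · exact hi.comp (fun s _ t _ h => by simpa using h) hmaps
  · simpa using hb
  · simpa using ha

theorem isCompact_Icc_inter_preimage {X : Type*} [TopologicalSpace X] {α : ℝ → X} {a b : ℝ}
    {P : Set X} (hα : ContinuousOn α (Icc a b)) (hP : IsClosed P) :
    IsCompact (Icc a b ∩ α ⁻¹' P) :=
  isCompact_Icc.of_isClosed_subset (hα.preimage_isClosed_of_isClosed isClosed_Icc hP)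
    inter_subset_left

theorem ArcJoined.trans {X : Type*} [TopologicalSpace X] [T2Space X] {S : Set X} {x y z : X}
    (hxy : ArcJoined S x y) (hyz : ArcJoined S y z) : ArcJoined S x z := by
  obtain ⟨α, a, b, hab, hαc, hαi, rfl, rfl, hαS⟩ := hxy
  obtain ⟨β, c, d, hcd, hβc, hβi, hβy, rfl, hβS⟩ := hyz
  have hcl : IsClosed (β '' Icc c d) := (isCompact_Icc.image_of_continuousOn hβc).isClosed
  obtain ⟨t, ⟨ht, s, hs, hst⟩, htmin⟩ :=
    (isCompact_Icc_inter_preimage hαc hcl).exists_isLeast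
      ⟨b, right_mem_Icc.2 hab, c, left_mem_Icc.2 hcd, hβy⟩
  have hat : Icc a t ⊆ Icc a b := Icc_subset_Icc_right ht.2
  have hsd : Icc s d ⊆ Icc c d := Icc_subset_Icc_left hs.1
  have hshift : ∀ u ∈ Icc a (t + (d - s)), t ≤ u → u - t + s ∈ Icc s d :=
    fun u hu h => ⟨by linarith, by linarith [hu.2]⟩
  refine ⟨concatPath α β t s, a, t + (d - s), by linarith [ht.1, hs.2],
    continuousOn_concatPath ht.1 hs.2 (hαc.mono hat) (hβc.mono hsd) hst.symm, ?_, ?_, ?_, ?_⟩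
  · refine injOn_concatPath (hαi.mono hat) (hβi.mono hsd) (fun u hu h => ⟨hu.1, h⟩)
      (fun u hu h => hshift u hu h.le) fun u hu v hv hsv huv => ?_
    have htu : t ≤ u := htmin ⟨hat hu, v, hsd hv, huv.symm⟩
    obtain rfl : t = u := le_antisymm htu hu.2
    exact hsv.ne (hβi hs (hsd hv) (hst.trans huv))
  · exact concatPath_of_le ht.1
  · rw [concatPath_of_ge hst.symm (by linarith [hs.2])]; congr 1; ring
  · intro u hu
    rcases le_or_gt u t with h | h
    · rw [concatPath_of_le h]; exact hαS (hat ⟨hu.1, h⟩)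
    · rw [concatPath_of_lt h]; exact hβS (hsd (hshift u hu h.le))

/-! ### Geodesics in tree-graded spaces -/

section Geodesics

variable {X : Type*} [MetricSpace X] {PX : Set (Set X)} {γ : ℝ → X} {a b : ℝ}

theorem IsGeodesicSegment.mono {a' b' : ℝ} (h : IsGeodesicSegment γ a b)
    (hsub : Icc a' b' ⊆ Icc a b) : IsGeodesicSegment γ a' b' :=
  fun s hs t ht => h s (hsub hs) t (hsub ht)

theorem IsGeodesicSegment.injOn (h : IsGeodesicSegment γ a b) : InjOn γ (Icc a b) := by
  intro s hs t ht hst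
  have := h s hs t ht
  rw [hst, dist_self] at this
  linarith [abs_eq_zero.1 this.symm]

theorem IsGeodesicSegment.continuousOn (h : IsGeodesicSegment γ a b) :
    ContinuousOn γ (Icc a b) :=
  (LipschitzOnWith.of_dist_le_mul (K := 1) fun s hs t ht => by
    simp [h s hs t ht, Real.dist_eq]).continuousOn

theorem IsGeodesicSegment.arcJoined (h : IsGeodesicSegment γ a b) (hab : a ≤ b) :
    ArcJoined (γ '' Icc a b) (γ a) (γ b) :=
  ⟨γ, a, b, hab, h.continuousOn, h.injOn, rfl, rfl, mapsTo_image _ _⟩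

/-- Simple loops parametrized by an arbitrary interval lie in a single piece. -/
theorem IsTreeGraded.exists_piece_of_loop (hX : IsTreeGraded X PX) {f : ℝ → X} (hab : a < b)
    (hf : ContinuousOn f (Icc a b)) (hinj : InjOn f (Ico a b)) (hfab : f a = f b) :
    ∃ P ∈ PX, ∀ t ∈ Icc a b, f t ∈ P := by
  have hba : 0 < b - a := sub_pos.2 hab
  have : Fact ((0 : ℝ) < 1) := ⟨one_pos⟩
  set g : ℝ → X := fun t => f (a + t * (b - a)) with hg
  have hg01 : g 0 = g (0 + 1) := by simp [hg, hfab]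
  have hgc : ContinuousOn g (Icc 0 (0 + 1)) := by
    refine hf.comp (by fun_prop) fun t ht => ⟨?_, ?_⟩ <;> nlinarith [ht.1, ht.2]
  have hgi : InjOn g (Ico 0 (0 + 1)) := by
    refine hinj.comp (fun s _ t _ h => ?_) fun t ht => ⟨?_, ?_⟩
    · simpa [hba.ne'] using h
    · nlinarith [ht.1, ht.2]
    · nlinarith [ht.1, ht.2]
  obtain ⟨P, hP, hsub⟩ := hX.t2 (AddCircle.liftIco 1 0 g)
    (AddCircle.liftIco_continuous hg01 hgc)
    (hgi.injective.comp (AddCircle.equivIco 1 0).injective)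
  have hmem : ∀ t ∈ Ico a b, f t ∈ P := by
    intro t ht
    have hu : (t - a) / (b - a) ∈ Ico (0 : ℝ) (0 + 1) :=
      ⟨div_nonneg (by linarith [ht.1]) hba.le, by rw [zero_add, div_lt_one hba]; linarith [ht.2]⟩
    have := hsub ⟨((t - a) / (b - a) : ℝ), rfl⟩
    rw [AddCircle.liftIco_coe_apply hu] at this
    convert this using 2
    field_simp
    ring
  refine ⟨P, hP, fun t ht => ?_⟩
  rcases ht.2.eq_or_lt with rfl | h
  · exact hfab ▸ hmem a ⟨le_rfl, hab⟩
  · exact hmem t ⟨ht.1, h⟩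

/-- An arc with endpoints in a piece is contained in that piece. -/
theorem IsTreeGraded.arc_subset (hX : IsTreeGraded X PX) {P : Set X} (hP : P ∈ PX)
    {α : ℝ → X} (hc : ContinuousOn α (Icc a b)) (hi : InjOn α (Icc a b))
    (ha : α a ∈ P) (hb : α b ∈ P) {t : ℝ} (ht : t ∈ Icc a b) : α t ∈ P := by
  by_contra htP
  obtain ⟨t₁, ⟨h₁, h₁P⟩, hmax⟩ := (isCompact_Icc_inter_preimage
    (hc.mono (Icc_subset_Icc_right ht.2)) (hX.closed P hP)).exists_isGreatest
      ⟨a, left_mem_Icc.2 ht.1, ha⟩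
  obtain ⟨t₂, ⟨h₂, h₂P⟩, hmin⟩ := (isCompact_Icc_inter_preimage
    (hc.mono (Icc_subset_Icc_left ht.1)) (hX.closed P hP)).exists_isLeast
      ⟨b, right_mem_Icc.2 ht.2, hb⟩
  have h₁t : t₁ < t := h₁.2.lt_of_ne (by rintro rfl; exact htP h₁P)
  have h₂t : t < t₂ := h₂.1.lt_of_ne (by rintro rfl; exact htP h₂P)
  have hsub : Icc t₁ t₂ ⊆ Icc a b := Icc_subset_Icc h₁.1 h₂.2
  have hends : α t₁ ≠ α t₂ := fun h => (h₁t.trans h₂t).ne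
    (hi (hsub ⟨le_rfl, (h₁t.trans h₂t).le⟩) (hsub ⟨(h₁t.trans h₂t).le, le_rfl⟩) h)
  obtain ⟨β, hβ, hβ0, hβ1, hβP⟩ := hX.geodesicSub P hP _ h₂P _ h₁P
  set l := dist (α t₂) (α t₁)
  have hl : 0 < l := dist_pos.2 hends.symm
  obtain ⟨Q, hQ, hQsub⟩ := hX.exists_piece_of_loop (f := concatPath α β t₂ 0)
    (a := t₁) (b := t₂ + (l - 0)) (by linarith)
    (continuousOn_concatPath (h₁t.trans h₂t).le hl.le (hc.mono hsub) hβ.continuousOn hβ0.symm)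
    (by
      refine injOn_concatPath (hi.mono hsub) (hβ.injOn.mono Ico_subset_Icc_self)
        (fun s hs h => ⟨hs.1, h⟩) (fun s hs h => ⟨by linarith, by linarith [hs.2]⟩) ?_
      intro s hs u hu hu0 hsu
      have hsP : α s ∈ P := hsu ▸ hβP u (Ico_subset_Icc_self hu)
      have huI := Ico_subset_Icc_self hu
      rcases le_or_gt s t with hst | hst
      · have := le_antisymm (hmax ⟨⟨h₁.1.trans hs.1, hst⟩, hsP⟩) hs.1
        rw [this, ← hβ1] at hsu
        exact hu.2.ne (hβ.injOn (right_mem_Icc.2 hl.le) huI hsu).symm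
      · have := le_antisymm hs.2 (hmin ⟨⟨hst.le, hs.2.trans h₂.2⟩, hsP⟩)
        rw [this, ← hβ0] at hsu
        exact hu0.ne (hβ.injOn (left_mem_Icc.2 hl.le) huI hsu))
    (by
      rw [concatPath_of_le (h₁t.trans h₂t).le, concatPath_of_lt (by linarith), ← hβ1]
      congr 1; ring)
  have hαQ : ∀ s ∈ Icc t₁ t₂, α s ∈ Q := fun s hs => by
    have := hQsub s ⟨hs.1, by linarith [hs.2]⟩
    rwa [concatPath_of_le hs.2] at this
  by_cases hQP : Q = P
  · exact htP (hQP ▸ hαQ t ⟨h₁t.le, h₂t.le⟩)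
  · exact hends (hX.t1 Q hQ P hP hQP ⟨hαQ _ ⟨le_rfl, (h₁t.trans h₂t).le⟩, h₁P⟩
      ⟨hαQ _ ⟨(h₁t.trans h₂t).le, le_rfl⟩, h₂P⟩)

/-- Two points of a piece joined by an arc otherwise outside of the piece are equal. -/
theorem IsTreeGraded.eq_of_arcJoined (hX : IsTreeGraded X PX) {P S : Set X} (hP : P ∈ PX)
    {y z : X} (hy : y ∈ P) (hz : z ∈ P) (hSP : S ∩ P ⊆ {y, z}) (h : ArcJoined S y z) :
    y = z := by
  obtain ⟨α, a, b, hab, hc, hi, rfl, rfl, hm⟩ := h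
  rcases hab.eq_or_lt with rfl | hlt
  · rfl
  have hmid : (a + b) / 2 ∈ Icc a b := ⟨by linarith, by linarith⟩
  rcases hSP ⟨hm hmid, hX.arc_subset hP hc hi hy hz hmid⟩ with h | h
  · linarith [hi hmid (left_mem_Icc.2 hab) h]
  · linarith [hi hmid (right_mem_Icc.2 hab) h]

theorem exists_arcJoined_nearest (hG : GeodesicSpace X) {P : Set X} {u y : X}
    (hy : dist u y = infDist u P) :
    ∃ S : Set X, ArcJoined S u y ∧ S ∩ P ⊆ {y} := by
  obtain ⟨η, hη, h0, h1⟩ := hG u y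
  refine ⟨η '' Icc 0 (dist u y), by simpa [h0, h1] using hη.arcJoined dist_nonneg, ?_⟩
  rintro _ ⟨⟨t, ht, rfl⟩, htP⟩
  have h2 := infDist_le_dist_of_mem (x := u) htP
  have h3 := hη 0 (left_mem_Icc.2 dist_nonneg) t ht
  rw [h0, zero_sub, abs_neg, abs_of_nonneg ht.1] at h3
  obtain rfl : t = dist u y := le_antisymm ht.2 (by linarith)
  exact h1

/-- Nearest points in a piece agree for two points joined by an arc avoiding the piece,
except possibly at these nearest points. -/
theorem IsTreeGraded.nearest_eq (hX : IsTreeGraded X PX) (hG : GeodesicSpace X) {P S : Set X}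
    (hP : P ∈ PX) {u v y z : X} (hy : y ∈ P) (hz : z ∈ P) (huy : dist u y = infDist u P)
    (hvz : dist v z = infDist v P) (huv : ArcJoined S u v) (hSP : S ∩ P ⊆ {y, z}) : y = z := by
  obtain ⟨S₁, hS₁, hS₁P⟩ := exists_arcJoined_nearest hG huy
  obtain ⟨S₂, hS₂, hS₂P⟩ := exists_arcJoined_nearest hG hvz
  refine hX.eq_of_arcJoined (S := S₁ ∪ S ∪ S₂) hP hy hz ?_
    (((hS₁.symm.mono ?_).trans (huv.mono ?_)).trans (hS₂.mono ?_))
  · rintro w ⟨(hw | hw) | hw, hwP⟩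
    · exact Or.inl (hS₁P ⟨hw, hwP⟩)
    · exact hSP ⟨hw, hwP⟩
    · exact Or.inr (hS₂P ⟨hw, hwP⟩)
  · exact subset_union_left.trans subset_union_left
  · exact subset_union_right.trans subset_union_left
  · exact subset_union_right

end Geodesics

/-! ### Finite disjoint unions of closed intervals -/

theorem exists_Icc_subset_of_subset_iUnion {k : ℕ} {a b : Fin k → ℝ}
    (hdisj : ∀ i j, i ≠ j → b i < a j ∨ b j < a i) {u v : ℝ} (huv : u ≤ v)
    (hsub : Icc u v ⊆ ⋃ i, Icc (a i) (b i)) : ∃ i, Icc u v ⊆ Icc (a i) (b i) := by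
  obtain ⟨j, hj⟩ := mem_iUnion.1 (hsub (left_mem_Icc.2 huv))
  refine ⟨j, Icc_subset_Icc hj.1 ?_⟩
  by_contra! hlt
  have hout : ∀ᶠ t in nhdsWithin (b j) (Ioi (b j)), ∀ i, t ∉ Icc (a i) (b i) := by
    rw [Filter.eventually_all]
    intro i
    by_cases hij : i = j
    · subst hij
      filter_upwards [self_mem_nhdsWithin] with t ht h
      exact absurd h.2 (not_le.2 ht)
    · refine nhdsWithin_le_nhds (isClosed_Icc.isOpen_compl.mem_nhds fun h => ?_)
      rcases hdisj i j hij with h' | h' <;> linarith [h.1, h.2, hj.1, hj.2]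
  obtain ⟨t, ht, htI⟩ := (hout.and (Ioo_mem_nhdsGT hlt)).exists
  obtain ⟨i, hi⟩ := mem_iUnion.1 (hsub ⟨hj.2.trans htI.1.le, htI.2.le⟩)
  exact ht i hi

/-- `[u, v]` is a maximal closed interval contained in `B`. -/
def IsMaxIcc (B : Set ℝ) (u v : ℝ) : Prop :=
  u ≤ v ∧ Icc u v ⊆ B ∧ ∀ u' v', u' ≤ u → v ≤ v' → Icc u' v' ⊆ B → u' = u ∧ v' = v

theorem isMaxIcc_iff_exists {k : ℕ} {a b : Fin k → ℝ} {B : Set ℝ} (hab : ∀ i, a i ≤ b i)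
    (hB : B = ⋃ i, Icc (a i) (b i)) (hdisj : ∀ i j, i ≠ j → b i < a j ∨ b j < a i) {u v : ℝ} :
    IsMaxIcc B u v ↔ ∃ i, a i = u ∧ b i = v := by
  have hsub : ∀ i, Icc (a i) (b i) ⊆ B := fun i =>
    hB ▸ subset_iUnion (fun i => Icc (a i) (b i)) i
  constructor
  · rintro ⟨huv, huvB, hmax⟩
    obtain ⟨i, hi⟩ := exists_Icc_subset_of_subset_iUnion hdisj huv (hB ▸ huvB)
    exact ⟨i, hmax _ _ (hi (left_mem_Icc.2 huv)).1 (hi (right_mem_Icc.2 huv)).2 (hsub i)⟩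
  · rintro ⟨i, rfl, rfl⟩
    refine ⟨hab i, hsub i, fun u' v' hu hv h => ?_⟩
    have huv := (hu.trans (hab i)).trans hv
    obtain ⟨j, hj⟩ := exists_Icc_subset_of_subset_iUnion hdisj huv (hB ▸ h)
    have h1 := (hj (left_mem_Icc.2 huv)).1
    have h2 := (hj (right_mem_Icc.2 huv)).2
    obtain rfl : i = j := by
      by_contra hij
      rcases hdisj i j hij with h' | h' <;> linarith [hab i]
    exact ⟨le_antisymm hu h1, le_antisymm h2 hv⟩

theorem exists_finset_isMaxIcc {k : ℕ} {a b : Fin k → ℝ} {B : Set ℝ} (hab : ∀ i, a i ≤ b i)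
    (hB : B = ⋃ i, Icc (a i) (b i)) (hdisj : ∀ i j, i ≠ j → b i < a j ∨ b j < a i)
    (g : ℝ → ℝ → ℕ) :
    ∃ S : Finset (ℝ × ℝ), (∀ p, p ∈ S ↔ IsMaxIcc B p.1 p.2) ∧
      ∑ i, g (a i) (b i) = ∑ p ∈ S, g p.1 p.2 := by
  classical
  refine ⟨Finset.univ.image fun i => (a i, b i), fun p => ?_, ?_⟩
  · simp [isMaxIcc_iff_exists hab hB hdisj, Prod.ext_iff]
  · rw [Finset.sum_image]
    intro i _ j _ hij
    simp only [Prod.mk.injEq] at hij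
    by_contra hne
    rcases hdisj i j hne with h | h <;> linarith [hab i, hab j, hij.1, hij.2]

/-- If `m` is the right end of a gap, then truncating at `m` does not change the maximal
intervals starting before `m`. -/
theorem isMaxIcc_diff_iff {U : Set ℝ} {c m M : ℝ} (hcm : c < m) (hmM : m ≤ M)
    (hgap : Ioo c m ⊆ U) {u v : ℝ} (hu : u < m) :
    IsMaxIcc (Icc 0 M \ U) u v ↔ IsMaxIcc (Icc 0 m \ U) u v := by
  have hmono : Icc 0 m \ U ⊆ Icc 0 M \ U := sdiff_subset_sdiff_left (Icc_subset_Icc_right hmM)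
  have hlt : ∀ {u v : ℝ}, u < m → Icc u v ⊆ Icc 0 M \ U → v < m := by
    intro u v hu h
    by_contra! hv
    obtain ⟨t, ht1, ht2⟩ := exists_between (max_lt hcm hu)
    exact (h ⟨((le_max_right _ _).trans_lt ht1).le, ht2.le.trans hv⟩).2
      (hgap ⟨(le_max_left _ _).trans_lt ht1, ht2⟩)
  have hsub : ∀ {u v : ℝ}, u < m → Icc u v ⊆ Icc 0 M \ U → Icc u v ⊆ Icc 0 m \ U :=
    fun hu h t ht => ⟨⟨(h ht).1.1, ht.2.trans (hlt hu h).le⟩, (h ht).2⟩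
  exact ⟨fun ⟨h1, h2, h3⟩ => ⟨h1, hsub hu h2, fun u' v' hu' hv' h =>
      h3 u' v' hu' hv' (h.trans hmono)⟩,
    fun ⟨h1, h2, h3⟩ => ⟨h1, h2.trans hmono, fun u' v' hu' hv' h =>
      h3 u' v' hu' hv' (hsub (hu'.trans_lt hu) h)⟩⟩

theorem IsMaxIcc.eq_of_ge {U : Set ℝ} {m M u v : ℝ} (hm : 0 ≤ m) (hU : U ⊆ Iio m)
    (h : IsMaxIcc (Icc 0 M \ U) u v) (hu : m ≤ u) : u = m ∧ v = M := by
  have hvM : v ≤ M := (h.2.1 (right_mem_Icc.2 h.1)).1.2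
  obtain ⟨h1, h2⟩ := h.2.2 m M hu hvM fun t ht =>
    ⟨⟨hm.trans ht.1, ht.2⟩, fun htU => absurd (hU htU) (not_lt.2 ht.1)⟩
  exact ⟨h1.symm, h2.symm⟩

theorem sum_components_eq {U : Set ℝ} {c m M : ℝ} (hm : 0 ≤ m) (hcm : c < m) (hmM : m ≤ M)
    (hgap : Ioo c m ⊆ U) (hU : U ⊆ Iio m) (g : ℝ → ℝ → ℕ) (hgm : g m m = 0) (hgM : g m M = 0)
    {k l : ℕ} {a b : Fin k → ℝ} {a' b' : Fin l → ℝ}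
    (hab : ∀ i, a i ≤ b i) (hB : Icc 0 M \ U = ⋃ i, Icc (a i) (b i))
    (hdisj : ∀ i j, i ≠ j → b i < a j ∨ b j < a i)
    (hab' : ∀ i, a' i ≤ b' i) (hB' : Icc 0 m \ U = ⋃ i, Icc (a' i) (b' i))
    (hdisj' : ∀ i j, i ≠ j → b' i < a' j ∨ b' j < a' i) :
    ∑ i, g (a i) (b i) = ∑ i, g (a' i) (b' i) := by
  classical
  obtain ⟨S, hS, hsum⟩ := exists_finset_isMaxIcc hab hB hdisj g
  obtain ⟨S', hS', hsum'⟩ := exists_finset_isMaxIcc hab' hB' hdisj' g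
  rw [hsum, hsum']
  have hfilter : S.filter (fun p => p.1 < m) = S'.filter (fun p => p.1 < m) := by
    ext p
    simp only [Finset.mem_filter, hS, hS']
    exact and_congr_left fun hp => isMaxIcc_diff_iff hcm hmM hgap hp
  have h1 : ∑ p ∈ S.filter (fun p => p.1 < m), g p.1 p.2 = ∑ p ∈ S, g p.1 p.2 :=
    Finset.sum_filter_of_ne fun p hp hne => by
      by_contra! hmp
      obtain ⟨h1, h2⟩ := ((hS p).1 hp).eq_of_ge hm hU hmp
      exact hne (by rw [h1, h2, hgM])
  have h2 : ∑ p ∈ S'.filter (fun p => p.1 < m), g p.1 p.2 = ∑ p ∈ S', g p.1 p.2 :=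
    Finset.sum_filter_of_ne fun p hp hne => by
      by_contra! hmp
      obtain ⟨h1, h2⟩ := ((hS' p).1 hp).eq_of_ge hm hU hmp
      exact hne (by rw [h1, h2, hgm])
  rw [← h1, ← h2, hfilter]

/-! ### Projections to pieces and the coloring -/

theorem floor_floorLen_eq_zero {X : Type*} [MetricSpace X] {PX : Set (Set X)}
    (hX : IsTreeGraded X PX) (γ : ℝ → X) {a b K : ℝ} (hab : a ≤ b) (hK : b - a < K) :
    Nat.floor (floorLen PX γ a b / K) = 0 := by
  have hle : floorLen PX γ a b ≤ b - a := by
    obtain ⟨P, hP, hbP⟩ := hX.covers (γ b)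
    refine sub_le_sub_right (csInf_le ⟨a, fun t ht => ht.1.1⟩ ?_) _
    exact ⟨right_mem_Icc.2 hab, P, hP, by simpa using hbP⟩
  rw [Nat.floor_eq_zero, div_lt_one (by linarith)]
  linarith

section Coloring

variable {X : Type*} [MetricSpace X] {PX : Set (Set X)} {n : ℕ} {r fr : ℝ} {xhat : X}
  {proj : Set X → X → X} {cP : Set X → X → Fin (n + 1)} {γ : ℝ → X} {a b : ℝ} {Q : Set X}

theorem ColoringSetup.mem_pieceComp (hs : ColoringSetup X PX n r fr xhat proj cP) (hQ : Q ∈ PX)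
    {y : X} (hy : y ∈ Q) (hd : dist (proj Q xhat) y ≤ 2 * r) :
    y ∈ pieceComp r xhat proj cP Q := by
  obtain ⟨η, hη, h0, h1, hηQ⟩ := hs.treeGraded.geodesicSub Q hQ _ (hs.projMem Q hQ xhat) _ hy
  set l := dist (proj Q xhat) y
  have hl : 0 ≤ l := dist_nonneg
  have hr := hs.rpos
  have hI : ∀ i : ℕ, i ≤ 3 → (i : ℝ) * (l / 3) ∈ Icc 0 l := fun i hi => by
    have : (i : ℝ) ≤ 3 := by exact_mod_cast hi
    exact ⟨by positivity, by nlinarith⟩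
  refine ⟨3, fun i => η (i * (l / 3)), by simpa using h0, ?_, fun i hi => ⟨hηQ _ (hI i hi), ?_⟩,
    fun i hi => ?_⟩
  · have h : ((3 : ℕ) : ℝ) * (l / 3) = l := by push_cast; ring
    exact (congrArg η h).trans h1
  · refine hs.ballZero Q hQ _ (hηQ _ (hI i hi)) ?_
    rw [← h0, hη _ (hI i hi) 0 (left_mem_Icc.2 hl), sub_zero, abs_of_nonneg (hI i hi).1]
    exact (hI i hi).2.trans hd
  · rw [hη _ (hI i hi.le) _ (hI (i + 1) hi)]
    have : (i : ℝ) * (l / 3) - ((i + 1 : ℕ) : ℝ) * (l / 3) = -(l / 3) := by push_cast; ring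
    rw [this, abs_neg, abs_of_nonneg (by positivity)]
    linarith

theorem ColoringSetup.proj_eq_self (hs : ColoringSetup X PX n r fr xhat proj cP) (hQ : Q ∈ PX)
    {y : X} (hy : y ∈ Q) : proj Q y = y := by
  have := hs.projDist Q hQ y
  rw [infDist_zero_of_mem hy] at this
  exact (dist_eq_zero.1 this).symm

theorem ColoringSetup.proj_eq_of_avoid (hs : ColoringSetup X PX n r fr xhat proj cP)
    (hQ : Q ∈ PX) (hab : a ≤ b) (hγ : IsGeodesicSegment γ a b) (hav : ∀ t ∈ Icc a b, γ t ∉ Q) :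
    proj Q (γ a) = proj Q (γ b) := by
  refine hs.treeGraded.nearest_eq hs.geodesic hQ (hs.projMem Q hQ _) (hs.projMem Q hQ _)
    (hs.projDist Q hQ _) (hs.projDist Q hQ _) (hγ.arcJoined hab) ?_
  rintro _ ⟨⟨t, ht, rfl⟩, htQ⟩
  exact absurd htQ (hav t ht)

theorem ColoringSetup.proj_left_eq (hs : ColoringSetup X PX n r fr xhat proj cP)
    (hQ : Q ∈ PX) (hγ : IsGeodesicSegment γ a b) {t : ℝ}
    (ht : IsLeast (Icc a b ∩ γ ⁻¹' Q) t) : proj Q (γ a) = γ t := by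
  obtain ⟨⟨htI, htQ : γ t ∈ Q⟩, hmin⟩ := ht
  refine hs.treeGraded.nearest_eq hs.geodesic hQ (hs.projMem Q hQ _) htQ
    (hs.projDist Q hQ _) (by rw [dist_self, infDist_zero_of_mem htQ])
    ((hγ.mono (Icc_subset_Icc_right htI.2)).arcJoined htI.1) ?_
  rintro _ ⟨⟨s, hs, rfl⟩, hsQ⟩
  exact Or.inr (congrArg γ (le_antisymm hs.2 (hmin ⟨⟨hs.1, hs.2.trans htI.2⟩, hsQ⟩)))

theorem ColoringSetup.proj_right_eq (hs : ColoringSetup X PX n r fr xhat proj cP)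
    (hQ : Q ∈ PX) (hγ : IsGeodesicSegment γ a b) {t : ℝ}
    (ht : IsGreatest (Icc a b ∩ γ ⁻¹' Q) t) : proj Q (γ b) = γ t := by
  obtain ⟨⟨htI, htQ : γ t ∈ Q⟩, hmax⟩ := ht
  refine (hs.treeGraded.nearest_eq hs.geodesic hQ htQ (hs.projMem Q hQ _)
    (by rw [dist_self, infDist_zero_of_mem htQ]) (hs.projDist Q hQ _)
    ((hγ.mono (Icc_subset_Icc_left htI.1)).arcJoined htI.2) ?_).symm
  rintro _ ⟨⟨s, hs, rfl⟩, hsQ⟩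
  exact Or.inl (congrArg γ (le_antisymm (hmax ⟨⟨htI.1.trans hs.1, hs.2⟩, hsQ⟩) hs.1))

theorem ColoringSetup.exists_isLeast_isGreatest (hs : ColoringSetup X PX n r fr xhat proj cP)
    (hQ : Q ∈ PX) (hγ : IsGeodesicSegment γ a b) (hne : (Icc a b ∩ γ ⁻¹' Q).Nonempty) :
    ∃ s t, IsLeast (Icc a b ∩ γ ⁻¹' Q) s ∧ IsGreatest (Icc a b ∩ γ ⁻¹' Q) t := by
  have hcomp := isCompact_Icc_inter_preimage hγ.continuousOn (hs.treeGraded.closed Q hQ)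
  obtain ⟨s, h⟩ := hcomp.exists_isLeast hne
  obtain ⟨t, h'⟩ := hcomp.exists_isGreatest hne
  exact ⟨s, t, h, h'⟩

theorem ColoringSetup.mem_of_between (hs : ColoringSetup X PX n r fr xhat proj cP)
    (hQ : Q ∈ PX) (hγ : IsGeodesicSegment γ a b) {s t u : ℝ} (hsI : s ∈ Icc a b)
    (hsQ : γ s ∈ Q) (htI : t ∈ Icc a b) (htQ : γ t ∈ Q) (hu : u ∈ Icc s t) : γ u ∈ Q :=
  have h := hγ.mono (Icc_subset_Icc hsI.1 htI.2)
  hs.treeGraded.arc_subset hQ h.continuousOn h.injOn hsQ htQ hu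

/-- A geodesic that stays in a piece `P` during `[s, m]` cannot meet another piece both
before and after time `m`. -/
theorem ColoringSetup.not_mem_of_lt (hs : ColoringSetup X PX n r fr xhat proj cP) {P : Set X}
    (hP : P ∈ PX) (hQ : Q ∈ PX) (hPQ : Q ≠ P) (hγ : IsGeodesicSegment γ a b) {s m u v : ℝ}
    (hsm : s < m) (hsI : s ∈ Icc a b) (hmI : m ∈ Icc a b) (hsP : γ s ∈ P) (hmP : γ m ∈ P)
    (huI : u ∈ Icc a b) (hvI : v ∈ Icc a b) (hum : u < m) (hmv : m ≤ v) (huQ : γ u ∈ Q) :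
    γ v ∉ Q := by
  intro hvQ
  have hw : max s u < m := max_lt hsm hum
  have hwI : max s u ∈ Icc a b := ⟨hsI.1.trans (le_max_left _ _), hw.le.trans hmI.2⟩
  refine hw.ne (hγ.injOn hwI hmI (hs.treeGraded.t1 Q hQ P hP hPQ ⟨?_, ?_⟩ ⟨?_, hmP⟩))
  · exact hs.mem_of_between hQ hγ huI huQ hvI hvQ ⟨le_max_right _ _, hw.le.trans hmv⟩
  · exact hs.mem_of_between hP hγ hsI hsP hmI hmP ⟨le_max_left _ _, hw.le⟩
  · exact hs.mem_of_between hQ hγ huI huQ hvI hvQ ⟨hum.le, hmv⟩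

end Coloring

section Truncation

variable {X : Type*} [MetricSpace X] {PX : Set (Set X)} {n : ℕ} {r fr : ℝ} {xhat : X}
  {proj : Set X → X → X} {cP : Set X → X → Fin (n + 1)} {γ : ℝ → X} {s m L : ℝ} {P Q : Set X}

/-- Truncating a geodesic at its exit time `m` from a piece, at most `r` before its end,
does not change the colors of the projections of its endpoint. -/
theorem ColoringSetup.color_proj_eq (hs : ColoringSetup X PX n r fr xhat proj cP)
    (hγ : IsGeodesicSegment γ 0 L) (hγ0 : γ 0 = xhat) (hP : P ∈ PX) (hsm : s < m)
    (hsmin : IsLeast (Icc 0 L ∩ γ ⁻¹' P) s) (hmmax : IsGreatest (Icc 0 L ∩ γ ⁻¹' P) m)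
    (hLm : L - m ≤ r) (hQ : Q ∈ PX) : cP Q (proj Q (γ L)) = cP Q (proj Q (γ m)) := by
  have hr := hs.rpos
  obtain ⟨⟨hsI, hsP⟩, -⟩ := hsmin
  have hmP := hmmax.1.2
  have hmI := hmmax.1.1
  by_cases hQP : Q = P
  · subst hQP
    rw [hs.proj_right_eq hQ hγ hmmax, hs.proj_eq_self hQ hmP]
  have hsub : Icc m L ⊆ Icc 0 L := Icc_subset_Icc_left hmI.1
  have hγ' := hγ.mono hsub
  by_cases hne : (Icc m L ∩ γ ⁻¹' Q).Nonempty
  · obtain ⟨t₁, t₂, h₁, h₂⟩ := hs.exists_isLeast_isGreatest hQ hγ' hne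
    have h₁I := h₁.1.1
    have hlow : IsLeast (Icc 0 L ∩ γ ⁻¹' Q) t₁ := by
      refine ⟨⟨hsub h₁I, h₁.1.2⟩, fun u hu => ?_⟩
      by_contra! hut
      rcases lt_or_ge u m with hum | hum
      · exact hs.not_mem_of_lt hP hQ hQP hγ hsm hsI hmI hsP hmP hu.1 (hsub h₁I) hum h₁I.1 hu.2
          h₁.1.2
      · exact hut.not_ge (h₁.2 ⟨⟨hum, hu.1.2⟩, hu.2⟩)
    have hzero : ∀ t ∈ Icc m L, γ t ∈ Q → cP Q (γ t) = 0 := fun t ht htQ => by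
      refine hs.ballZero Q hQ _ htQ ?_
      rw [← hγ0, hs.proj_left_eq hQ hγ hlow, hγ' t ht t₁ h₁I, abs_le]
      constructor <;> linarith [ht.1, ht.2, h₁I.1, h₁I.2]
    rw [hs.proj_left_eq hQ hγ' h₁, hs.proj_right_eq hQ hγ' h₂, hzero _ h₁I h₁.1.2,
      hzero _ h₂.1.1 h₂.1.2]
  · rw [hs.proj_eq_of_avoid hQ hmI.2 hγ' fun t ht htQ => hne ⟨t, ht, htQ⟩]

/-- A piece met by a geodesic only during its final subpath of length at most `r` is not
long. -/
theorem ColoringSetup.not_isLongPiece (hs : ColoringSetup X PX n r fr xhat proj cP)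
    (hγ : IsGeodesicSegment γ 0 L) (hγ0 : γ 0 = xhat) (hLm : L - m ≤ r)
    (hsub : Icc 0 L ∩ γ ⁻¹' Q ⊆ Ici m) : ¬ IsLongPiece PX r xhat proj cP γ L Q := by
  rintro ⟨hQ, ⟨t, ht, htQ⟩, hlong⟩
  have hr := hs.rpos
  obtain ⟨t₁, t₂, h₁, h₂⟩ := hs.exists_isLeast_isGreatest hQ hγ ⟨t, ht, htQ⟩
  refine hlong ?_
  rw [hs.proj_right_eq hQ hγ h₂]
  refine hs.mem_pieceComp hQ h₂.1.2 ?_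
  have h1 : m ≤ t₁ := hsub h₁.1
  have h2 := h₁.2 h₂.1
  rw [← hγ0, hs.proj_left_eq hQ hγ h₁, hγ _ h₁.1.1 _ h₂.1.1, abs_le]
  constructor <;> linarith [h₂.1.1.2]

/-- Truncating a geodesic at its exit time `m` from a piece, at most `r` before its end,
does not change its long pieces, and these are only met before time `m`. -/
theorem ColoringSetup.isLongPiece_iff (hs : ColoringSetup X PX n r fr xhat proj cP)
    (hγ : IsGeodesicSegment γ 0 L) (hγ0 : γ 0 = xhat) (hP : P ∈ PX) (hsm : s < m)
    (hsmin : IsLeast (Icc 0 L ∩ γ ⁻¹' P) s) (hmmax : IsGreatest (Icc 0 L ∩ γ ⁻¹' P) m)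
    (hLm : L - m ≤ r) :
    (IsLongPiece PX r xhat proj cP γ L Q ↔ IsLongPiece PX r xhat proj cP γ m Q) ∧
      (IsLongPiece PX r xhat proj cP γ L Q → Icc 0 L ∩ γ ⁻¹' Q = Icc 0 m ∩ γ ⁻¹' Q) := by
  obtain ⟨⟨hsI, hsP⟩, -⟩ := hsmin
  have hmP := hmmax.1.2
  have hmI := hmmax.1.1
  have hsub : Icc 0 m ⊆ Icc 0 L := Icc_subset_Icc_right hmI.2
  have hγ' := hγ.mono hsub
  by_cases hQ : Q ∈ PX
  swap
  · exact ⟨⟨fun h => absurd h.1 hQ, fun h => absurd h.1 hQ⟩, fun h => absurd h.1 hQ⟩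
  by_cases hlate : Icc 0 L ∩ γ ⁻¹' Q ⊆ Ici m
  · have h1 := hs.not_isLongPiece hγ hγ0 hLm hlate
    have h2 := hs.not_isLongPiece hγ' hγ0 (m := m) (by linarith [hs.rpos])
      fun t ht => hlate ⟨hsub ht.1, ht.2⟩
    exact ⟨iff_of_false h1 h2, fun h => absurd h h1⟩
  obtain ⟨u, ⟨huI, huQ⟩, hum⟩ := not_subset.1 hlate
  rw [mem_Ici, not_le] at hum
  have hhits : Icc 0 L ∩ γ ⁻¹' Q = Icc 0 m ∩ γ ⁻¹' Q := by
    refine Subset.antisymm (fun v hv => ⟨⟨hv.1.1, ?_⟩, hv.2⟩) (inter_subset_inter_left _ hsub)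
    by_cases hQP : Q = P
    · subst hQP
      exact hmmax.2 hv
    · by_contra! hmv
      exact hs.not_mem_of_lt hP hQ hQP hγ hsm hsI hmI hsP hmP huI hv.1 hum hmv.le huQ hv.2
  have hproj : proj Q (γ L) = proj Q (γ m) := by
    obtain ⟨_, t, -, ht⟩ := hs.exists_isLeast_isGreatest hQ hγ ⟨u, huI, huQ⟩
    rw [hs.proj_right_eq hQ hγ ht, hs.proj_right_eq hQ hγ' (hhits ▸ ht)]
  refine ⟨?_, fun _ => hhits⟩
  unfold IsLongPiece
  rw [hproj]
  exact and_congr_right fun _ => and_congr_left fun _ =>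
    iff_of_true ⟨u, huI, huQ⟩ ⟨u, ⟨huI.1, hum.le⟩, huQ⟩

/-- The union of the interiors of the reduced long pieces of the geodesic `γ : [0, L] → X`,
in parameter space. -/
noncomputable def reducedLongSet (PX : Set (Set X)) (r : ℝ) (xhat : X)
    (proj : Set X → X → X) (cP : Set X → X → Fin (n + 1)) (γ : ℝ → X) (L : ℝ) : Set ℝ :=
  ⋃ P ∈ {P | IsLongPiece PX r xhat proj cP γ L P},
    Ioo (pieceStart γ L P + r / 2) (pieceEnd γ L P)

theorem ColoringSetup.reducedLongSet_eq (hs : ColoringSetup X PX n r fr xhat proj cP)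
    (hγ : IsGeodesicSegment γ 0 L) (hγ0 : γ 0 = xhat) (hP : P ∈ PX) (hsm : s < m)
    (hsmin : IsLeast (Icc 0 L ∩ γ ⁻¹' P) s) (hmmax : IsGreatest (Icc 0 L ∩ γ ⁻¹' P) m)
    (hLm : L - m ≤ r) :
    reducedLongSet PX r xhat proj cP γ L = reducedLongSet PX r xhat proj cP γ m := by
  have key (Q : Set X) := hs.isLongPiece_iff (Q := Q) hγ hγ0 hP hsm hsmin hmmax hLm
  refine iUnion_congr fun Q => iUnion_congr_Prop (key Q).1 fun hQ => ?_
  have hhits := (key Q).2 ((key Q).1.2 hQ)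
  change Ioo (sInf (Icc 0 L ∩ γ ⁻¹' Q) + r / 2) (sSup (Icc 0 L ∩ γ ⁻¹' Q)) = _
  rw [hhits]
  rfl

theorem reducedLongSet_subset_Iio :
    reducedLongSet PX r xhat proj cP γ L ⊆ Iio L := by
  refine iUnion₂_subset fun Q hQ t ht => ht.2.trans_le ?_
  obtain ⟨u, hu⟩ := hQ.2.1
  exact csSup_le ⟨u, hu⟩ fun v hv => hv.1.2

end Truncation

/-- In the Setup, if `d(x, P) ≤ r` and `π_P x ∉ 𝔠_P`, then
`c*_X(x) = c*_X(π_P x)`. -/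
theorem cX_of_r_close_projection (X : Type*) [MetricSpace X] [CompleteSpace X]
    (PX : Set (Set X)) (n : ℕ) (r fr : ℝ) (xhat : X)
    (proj : Set X → X → X) (cP : Set X → X → Fin (n + 1))
    (hsetup : ColoringSetup X PX n r fr xhat proj cP)
    (cX : X → Fin (n + 1))
    (hcX : ∀ (γ : ℝ → X) (L : ℝ), 0 ≤ L → IsGeodesicSegment γ 0 L → γ 0 = xhat →
      ColorValue PX r fr xhat proj cP γ L (cX (γ L)))
    (P : Set X) (hP : P ∈ PX) (x : X)
    (hclose : Metric.infDist x P ≤ r)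
    (hout : proj P x ∉ pieceComp r xhat proj cP P) :
    cX x = cX (proj P x) := by
  have hr := hsetup.rpos
  have hfr := hsetup.rlefr
  obtain ⟨γ, hγ, hγ0, hγL⟩ := hsetup.geodesic xhat x
  set L := dist xhat x
  have hL : 0 ≤ L := dist_nonneg
  have hfar : 2 * r < dist (proj P xhat) (proj P x) := by
    by_contra! h
    exact hout (hsetup.mem_pieceComp hP (hsetup.projMem P hP x) h)
  have hmeet : (Icc 0 L ∩ γ ⁻¹' P).Nonempty := by
    by_contra hne
    have h := hsetup.proj_eq_of_avoid hP hL hγ fun t ht htP => hne ⟨t, ht, htP⟩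
    rw [hγ0, hγL] at h
    rw [h, dist_self] at hfar
    linarith
  obtain ⟨s, m, hsmin, hmmax⟩ := hsetup.exists_isLeast_isGreatest hP hγ hmeet
  have hmI : m ∈ Icc 0 L := hmmax.1.1
  have hγs : proj P xhat = γ s := hγ0 ▸ hsetup.proj_left_eq hP hγ hsmin
  have hγm : proj P x = γ m := by
    have h := hsetup.proj_right_eq hP hγ hmmax
    rwa [hγL] at h
  have hsm : s + 2 * r < m := by
    have h : s ≤ m := hsmin.2 hmmax.1
    rw [hγs, hγm, hγ _ hsmin.1.1 _ hmI, abs_sub_comm, abs_of_nonneg (by linarith)] at hfar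
    linarith
  have hLm : L - m ≤ r := by
    have h := hsetup.projDist P hP x
    rw [hγm, ← hγL, hγ _ (right_mem_Icc.2 hL) _ hmI, hγL, abs_of_nonneg (by linarith [hmI.2])] at h
    linarith
  have hγm' : IsGeodesicSegment γ 0 m := hγ.mono (Icc_subset_Icc_right hmI.2)
  have hUeq := hsetup.reducedLongSet_eq hγ hγ0 hP (by linarith) hsmin hmmax hLm
  have hgap : Ioo (s + r / 2) m ⊆ reducedLongSet PX r xhat proj cP γ L := by
    have hlong : IsLongPiece PX r xhat proj cP γ L P := ⟨hP, ⟨m, hmmax.1⟩, hγL ▸ hout⟩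
    have hstart : pieceStart γ L P = s := hsmin.csInf_eq
    have hend : pieceEnd γ L P = m := hmmax.csSup_eq
    refine subset_iUnion₂_of_subset P hlong ?_
    rw [hstart, hend]
  obtain ⟨Ps, k, a, b, hPs, hab, hB, hdisj, hv⟩ := hcX γ L hL hγ hγ0
  obtain ⟨Ps', k', a', b', hPs', hab', hB', hdisj', hv'⟩ := hcX γ m hmI.1 hγm' hγ0
  change Icc 0 L \ reducedLongSet PX r xhat proj cP γ L = _ at hB
  change Icc 0 m \ reducedLongSet PX r xhat proj cP γ m = _ at hB'
  have hcolor : ∀ Q ∈ PX, cP Q (proj Q (γ L)) = cP Q (proj Q (γ m)) := fun Q hQ =>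
    hsetup.color_proj_eq hγ hγ0 hP (by linarith) hsmin hmmax hLm hQ
  have hPsPs' : Ps = Ps' := by
    refine Finset.coe_injective ?_
    rw [hPs, hPs']
    ext Q
    exact and_congr_right fun hQ => by rw [hcolor Q hQ]
  have hmem : ∀ Q ∈ Ps, Q ∈ PX := fun Q hQ => by
    have h : Q ∈ (Ps : Set (Set X)) := hQ
    rw [hPs] at h
    exact h.1
  have hsum : ∑ i, ⌊floorLen PX γ (a i) (b i) / (99 * fr)⌋₊ =
      ∑ i, ⌊floorLen PX γ (a' i) (b' i) / (99 * fr)⌋₊ :=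
    sum_components_eq hmI.1 (by linarith) hmI.2 hgap
      (hUeq ▸ reducedLongSet_subset_Iio)
      (fun u v => ⌊floorLen PX γ u v / (99 * fr)⌋₊)
      (floor_floorLen_eq_zero hsetup.treeGraded γ le_rfl (by linarith))
      (floor_floorLen_eq_zero hsetup.treeGraded γ hmI.2 (by linarith))
      hab hB hdisj hab' (hUeq ▸ hB') hdisj'
  rw [hγm, ← hγL]
  refine Fin.ext ?_
  rw [hv, hv', hsum, ← hPsPs', Finset.sum_congr rfl fun Q hQ => by rw [hcolor Q (hmem Q hQ)]]
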